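/- Let p be a prime. In the multivariate polynomial ring (ZMod p)[t_1, …, t_{p−1}], the following identity holds: ( ∑_{σ ∈ S_{p−1}} t_{σ(1)}·(t_{σ(1)}+t_{σ(2)})·…·(t_{σ(1)}+…+t_{σ(p−1)}) ) · (t_1 + … + t_{p−1}) = t_1^p + t_2^p + … + t_{p−1}^p. -/

import Mathlib

open Finset

section AscendingSum

variable {ι κ R S : Type*} [DecidableEq ι] [DecidableEq κ] [CommRing R] [CommRing S]

/-- For `#A = n`, the sum over all orderings `a₁, …, aₙ` of `A` of
`x (x + t a₁) (x + t a₁ + t a₂) ⋯ (x + t a₁ + ⋯ + t aₙ₋₁)`, defined by recursion on `n`. -/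
def ascendingSum (t : ι → R) : ℕ → Finset ι → R → R
  | 0, _, _ => 1
  | n + 1, A, x => x * ∑ a ∈ A, ascendingSum t n (A.erase a) (x + t a)

theorem ascendingSum_zero (t : ι → R) (A : Finset ι) (x : R) : ascendingSum t 0 A x = 1 := rfl

theorem ascendingSum_succ (t : ι → R) (n : ℕ) (A : Finset ι) (x : R) :
    ascendingSum t (n + 1) A x = x * ∑ a ∈ A, ascendingSum t n (A.erase a) (x + t a) := rfl

theorem ascendingSum_congr {t u : ι → R} (n : ℕ) (A : Finset ι) (x : R)
    (h : ∀ a ∈ A, t a = u a) : ascendingSum t n A x = ascendingSum u n A x := by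
  induction n generalizing A x with
  | zero => rfl
  | succ n ih =>
    rw [ascendingSum_succ, ascendingSum_succ]
    congr 1
    refine sum_congr rfl fun a ha => ?_
    rw [h a ha, ih _ _ fun b hb => h b (mem_of_mem_erase hb)]

theorem ascendingSum_map (t : κ → R) (e : ι ↪ κ) (n : ℕ) (A : Finset ι) (x : R) :
    ascendingSum t n (A.map e) x = ascendingSum (t ∘ e) n A x := by
  induction n generalizing A x with
  | zero => rfl
  | succ n ih =>
    rw [ascendingSum_succ, ascendingSum_succ, sum_map]
    congr 1
    refine sum_congr rfl fun a _ => ?_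
    rw [← Finset.map_erase, ih]
    rfl

theorem map_ascendingSum (f : R →+* S) (t : ι → R) (n : ℕ) (A : Finset ι) (x : R) :
    f (ascendingSum t n A x) = ascendingSum (f ∘ t) n A (f x) := by
  induction n generalizing A x with
  | zero => simp [ascendingSum_zero]
  | succ n ih => simp [ascendingSum_succ, ih]

theorem ascendingSum_of_eq_zero {t : ι → R} {n : ℕ} {A : Finset ι} (hA : #A = n)
    (h : ∀ a ∈ A, t a = 0) (x : R) : ascendingSum t n A x = n.factorial * x ^ n := by
  induction n generalizing A with
  | zero => simp [ascendingSum_zero]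
  | succ n ih =>
    rw [ascendingSum_succ, sum_congr rfl fun a ha => by
      rw [h a ha, add_zero, ih (by rw [card_erase_of_mem ha, hA]; rfl)
        fun b hb => h b (mem_of_mem_erase hb)]]
    rw [sum_const, hA, Nat.factorial_succ, nsmul_eq_mul]
    push_cast
    ring

theorem sum_powerset_sdiff_comm {M : Type*} [AddCommMonoid M] (A : Finset ι)
    (f : Finset ι → Finset ι → M) :
    ∑ B ∈ A.powerset, f B (A \ B) = ∑ B ∈ A.powerset, f (A \ B) B := by
  refine sum_bij' (fun B _ => A \ B) (fun B _ => A \ B) ?_ ?_ ?_ ?_ ?_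
  · intro B _; simp
  · intro B _; simp
  · intro B hB; simpa using mem_powerset.1 hB
  · intro B hB; simpa using mem_powerset.1 hB
  · intro B hB; rw [Finset.sdiff_sdiff_eq_self (mem_powerset.1 hB)]

/-- Peeling one element off the right factor of a convolution over subsets. -/
theorem sum_choose_mul_ascendingSum_erase (t : ι → R) {n : ℕ} {A : Finset ι} (hA : #A = n + 1)
    (f : Finset ι → R) (y : R) :
    y * ∑ a ∈ A, ∑ B ∈ (A.erase a).powerset, (n.choose #B : R) *
        (f B * ascendingSum t #(A.erase a \ B) (A.erase a \ B) (y + t a)) =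
      ∑ B ∈ A.powerset, (n.choose #B : R) * (f B * ascendingSum t #(A \ B) (A \ B) y) := by
  rw [sum_comm' (t' := A.powerset) (s' := fun B => A \ B), mul_sum]
  · refine sum_congr rfl fun B hB => ?_
    have hBA := mem_powerset.1 hB
    have hcard := card_sdiff_add_card_eq_card hBA
    rcases hm : #(A \ B) with _ | m
    · rw [Nat.choose_eq_zero_of_lt (by omega)]
      simp
    · rw [ascendingSum_succ, mul_sum, mul_sum, mul_sum, mul_sum]
      refine sum_congr rfl fun a ha => ?_
      rw [erase_sdiff_comm, card_erase_of_mem ha, hm, Nat.add_sub_cancel]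
      ring
  · intro a B
    simp only [mem_powerset, mem_sdiff, subset_erase]
    tauto

theorem ascendingSum_add (t : ι → R) {n : ℕ} {A : Finset ι} (hA : #A = n) (x y : R) :
    ascendingSum t n A (x + y) = ∑ B ∈ A.powerset, (n.choose #B : R) *
      (ascendingSum t #B B x * ascendingSum t #(A \ B) (A \ B) y) := by
  induction n generalizing A x y with
  | zero =>
    obtain rfl := card_eq_zero.1 hA
    simp [ascendingSum_zero]
  | succ n ih =>
    have hcard : ∀ a ∈ A, #(A.erase a) = n := fun a ha => by rw [card_erase_of_mem ha, hA]; rfl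
    have hleft : x * ∑ a ∈ A, ascendingSum t n (A.erase a) (x + y + t a) =
        ∑ B ∈ A.powerset, (n.choose #(A \ B) : R) *
          (ascendingSum t #B B x * ascendingSum t #(A \ B) (A \ B) y) := by
      rw [sum_congr rfl fun a ha => by
        rw [show x + y + t a = y + (x + t a) by ring, ih (hcard a ha)]]
      rw [sum_choose_mul_ascendingSum_erase t hA (fun B => ascendingSum t #B B y) x,
        sum_powerset_sdiff_comm A fun B C => (n.choose #B : R) *
          (ascendingSum t #B B y * ascendingSum t #C C x)]
      exact sum_congr rfl fun B _ => by ring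
    have hright : y * ∑ a ∈ A, ascendingSum t n (A.erase a) (x + y + t a) =
        ∑ B ∈ A.powerset, (n.choose #B : R) *
          (ascendingSum t #B B x * ascendingSum t #(A \ B) (A \ B) y) := by
      rw [sum_congr rfl fun a ha => by rw [add_assoc, ih (hcard a ha)]]
      exact sum_choose_mul_ascendingSum_erase t hA (fun B => ascendingSum t #B B x) y
    rw [ascendingSum_succ, add_mul, hleft, hright, ← sum_add_distrib]
    refine sum_congr rfl fun B hB => ?_
    have hB' := card_sdiff_add_card_eq_card (mem_powerset.1 hB)
    rw [← add_mul]
    congr 1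
    norm_cast
    rcases hk : #B with _ | k
    · rw [Nat.choose_eq_zero_of_lt (by omega)]
      simp
    · rw [Nat.choose_succ_succ, ← Nat.choose_symm_of_eq_add (show n = #(A \ B) + k by omega)]

theorem ascendingSum_prime_add {p : ℕ} (hp : p.Prime) [CharP R p] (t : ι → R) {A : Finset ι}
    (hA : #A = p) (x y : R) :
    ascendingSum t p A (x + y) = ascendingSum t p A x + ascendingSum t p A y := by
  have hne : A ≠ ∅ := by
    rintro rfl
    exact hp.ne_zero (by simpa using hA.symm)
  rw [ascendingSum_add t hA, ← sum_subset (s₁ := {A, ∅}), sum_pair hne]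
  · simp [hA, ascendingSum_zero]
  · simp [insert_subset_iff]
  · intro B hB hB'
    simp only [mem_insert, mem_singleton, not_or] at hB'
    have hlt : #B < p := hA ▸ card_lt_card ((mem_powerset.1 hB).ssubset_of_ne hB'.1)
    have hpos : #B ≠ 0 := by simpa using hB'.2
    rw [(CharP.cast_eq_zero_iff R p _).2 (hp.dvd_choose_self hpos hlt), zero_mul]

open Polynomial in
theorem natDegree_ascendingSum_le (t : ι → R) {n : ℕ} {A : Finset ι} (hA : #A = n) (c : R) :
    (ascendingSum (C ∘ t) n A (X + C c)).natDegree ≤ n ∧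
      (ascendingSum (C ∘ t) n A (X + C c)).coeff n = n.factorial := by
  induction n generalizing A c with
  | zero => simp [ascendingSum_zero]
  | succ n ih =>
    have hcard : ∀ a ∈ A, #(A.erase a) = n := fun a ha => by rw [card_erase_of_mem ha, hA]; rfl
    have harg : ∀ a, (X + C c + (C ∘ t) a : R[X]) = X + C (c + t a) := fun a => by
      simp [add_assoc]
    simp only [ascendingSum_succ, harg]
    have hdeg : (∑ a ∈ A, ascendingSum (C ∘ t) n (A.erase a) (X + C (c + t a))).natDegree ≤ n :=
      natDegree_sum_le_of_forall_le _ _ fun a ha => (ih (hcard a ha) _).1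
    have hX : (X + C c : R[X]).natDegree ≤ 1 := by compute_degree
    refine ⟨natDegree_mul_le.trans (by omega), ?_⟩
    rw [add_comm n 1, coeff_mul_add_eq_of_natDegree_le hX hdeg, finsetSum_coeff,
      sum_congr rfl fun a ha => (ih (hcard a ha) _).2, sum_const, hA, add_comm 1 n,
      Nat.factorial_succ]
    simp

open Polynomial in
/-- In characteristic `p`, the sum over all orderings `a₁, …, aₚ` of a `p`-element set of
`(x + t a₁) (x + t a₁ + t a₂) ⋯ (x + t a₁ + ⋯ + t aₚ₋₁)` does not depend on `x`. -/
theorem sum_ascendingSum_erase_eq {p : ℕ} (hp : p.Prime) [CharP R p] [IsDomain R] [Infinite R]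
    (t : ι → R) {A : Finset ι} (hA : #A = p) (x : R) :
    ∑ a ∈ A, ascendingSum t (p - 1) (A.erase a) (x + t a) =
      ∑ a ∈ A, ascendingSum t (p - 1) (A.erase a) (t a) := by
  obtain ⟨n, rfl⟩ : ∃ n, p = n + 1 := ⟨p - 1, by have := hp.pos; omega⟩
  simp only [Nat.add_sub_cancel]
  set Q : R[X] := ∑ a ∈ A, ascendingSum (C ∘ t) n (A.erase a) (X + C (t a)) with hQ
  have hP : ascendingSum (C ∘ t) (n + 1) A X = X * Q := rfl
  have heval : ∀ r, Q.eval r = ∑ a ∈ A, ascendingSum t n (A.erase a) (r + t a) := fun r => by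
    rw [hQ, eval_finsetSum]
    refine sum_congr rfl fun a _ => ?_
    rw [← coe_evalRingHom, map_ascendingSum]
    congr 1
    · ext; simp
    · simp
  suffices hconst : Q = C (Q.coeff 0) by
    have h0 := heval 0
    have hx := heval x
    rw [hconst, eval_C] at h0 hx
    simp only [zero_add] at h0
    rw [← hx, h0]
  obtain ⟨hdeg, hlead⟩ := natDegree_ascendingSum_le t hA 0
  rw [C_0, add_zero, hP] at hdeg hlead
  rw [coeff_X_mul, (CharP.cast_eq_zero_iff R (n + 1) _).2 (hp.dvd_factorial.2 le_rfl)] at hlead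
  have hder : derivative (X * Q) = C (Q.coeff 0) := by
    refine Polynomial.funext fun r => ?_
    rw [← taylor_coeff_one, taylor_apply, ← hP, ← coe_compRingHom_apply, map_ascendingSum]
    have harg : (compRingHom (X + C r)) ∘ (C ∘ t) = C ∘ t := by ext; simp
    rw [harg, coe_compRingHom_apply, X_comp, ascendingSum_prime_add hp _ hA, hP]
    have hC : ascendingSum (C ∘ t) (n + 1) A (C r) = C (ascendingSum t (n + 1) A r) :=
      (map_ascendingSum C t (n + 1) A r).symm
    rw [hC, coeff_add, coeff_C_succ, add_zero, eval_C, coeff_X_mul]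
  ext k
  rcases k with _ | k
  · simp
  rw [coeff_C_succ]
  have hk := congrArg (fun q => q.coeff (k + 1)) hder
  simp only [coeff_derivative, coeff_X_mul, coeff_C_succ] at hk
  rcases lt_trichotomy (k + 1) n with h | h | h
  · refine (mul_eq_zero.1 hk).resolve_right fun h0 => ?_
    have h1 : ((k + 2 : ℕ) : R) = 0 := by push_cast at h0 ⊢; linear_combination h0
    have := Nat.le_of_dvd (by omega) ((CharP.cast_eq_zero_iff R (n + 1) _).1 h1)
    omega
  · rw [h, hlead]
  · rw [← coeff_X_mul]
    exact coeff_eq_zero_of_natDegree_lt (by omega)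

theorem ascendingSum_erase_eq_of_eq_zero (t : ι → R) (n : ℕ) {A : Finset ι} {a b : ι}
    (ha : a ∈ A) (hb : b ∈ A) (hta : t a = 0) (htb : t b = 0) (x : R) :
    ascendingSum t n (A.erase a) x = ascendingSum t n (A.erase b) x := by
  have hmap : (A.erase a).map (Equiv.swap a b).toEmbedding = A.erase b := by
    ext c
    rw [mem_map_equiv, Equiv.symm_swap, mem_erase, mem_erase]
    rcases eq_or_ne c a with rfl | hca
    · simp only [Equiv.swap_apply_left]; tauto
    rcases eq_or_ne c b with rfl | hcb
    · simp
    · rw [Equiv.swap_apply_of_ne_of_ne hca hcb]; tauto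
  rw [← hmap, ascendingSum_map]
  refine ascendingSum_congr _ _ _ fun c _ => ?_
  simp only [Function.comp_apply, Equiv.coe_toEmbedding, Equiv.swap_apply_def]
  split_ifs <;> simp_all

theorem ascendingSum_erase_eq_pow_sub_pow {p : ℕ} (hp : p.Prime) [CharP R p] [IsDomain R]
    [Infinite R] {A : Finset ι} (hA : #A = p) (t : ι → R) {a : ι} (ha : a ∈ A) (hta : t a = 0)
    (x : R) :
    ascendingSum t (p - 1) (A.erase a) x =
      (∑ i ∈ A, t i) ^ (p - 1) - (∑ i ∈ A, t i + x) ^ (p - 1) := by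
  classical
  induction hj : #{i ∈ A | t i ≠ 0} generalizing t a x with
  | zero =>
    have hzero : ∀ i ∈ A, t i = 0 := by simpa [filter_eq_empty_iff] using hj
    have := Fact.mk hp
    have hwilson : (((p - 1).factorial : ℕ) : R) = -1 := by
      have := congrArg (ZMod.castHom (dvd_refl p) R) (ZMod.wilsons_lemma p)
      rwa [map_natCast, map_neg, map_one] at this
    rw [ascendingSum_of_eq_zero (by rw [card_erase_of_mem ha, hA])
      fun i hi => hzero i (mem_of_mem_erase hi), hwilson, sum_eq_zero hzero,
      zero_pow (by have := hp.two_le; omega)]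
    ring
  | succ j ih =>
    set s := ∑ i ∈ A, t i with hs
    have hnonzero : ∀ b ∈ A, t b ≠ 0 → ∀ y,
        ascendingSum t (p - 1) (A.erase b) (y + t b) = (s - t b) ^ (p - 1) - (s + y) ^ (p - 1) := by
      intro b hb htb y
      have hu : ∀ i ∈ A.erase b, t i = Function.update t b 0 i := fun i hi => by
        rw [Function.update_of_ne (ne_of_mem_erase hi)]
      have hsum : ∑ i ∈ A, Function.update t b 0 i = s - t b := by
        rw [hs, sum_update_of_mem hb, ← sum_sdiff (singleton_subset_iff.2 hb)]
        simp
      rw [ascendingSum_congr _ _ _ hu, ih _ hb (by simp), hsum]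
      · ring
      · have hfilter : {i ∈ A | Function.update t b 0 i ≠ 0} = {i ∈ A | t i ≠ 0}.erase b := by
          ext i
          rcases eq_or_ne i b with rfl | hib <;> simp [*]
        rw [hfilter, card_erase_of_mem (by simp [hb, htb]), hj]
        rfl
    have hp1 : p - 1 = p - 2 + 1 := by have := hp.two_le; omega
    have hat_zero : ascendingSum t (p - 1) (A.erase a) 0 = 0 := by
      rw [hp1, ascendingSum_succ, zero_mul]
    have hdiff : ∑ b ∈ A, (ascendingSum t (p - 1) (A.erase b) (x + t b) -
        ascendingSum t (p - 1) (A.erase b) (t b) + ((s + x) ^ (p - 1) - s ^ (p - 1))) = 0 := by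
      rw [sum_add_distrib, sum_sub_distrib, sum_ascendingSum_erase_eq hp t hA, sum_const, hA,
        nsmul_eq_mul, CharP.cast_eq_zero]
      ring
    rw [← sum_filter_add_sum_filter_not A (fun b => t b ≠ 0), sum_eq_zero, zero_add,
      sum_congr rfl (g := fun _ => ascendingSum t (p - 1) (A.erase a) x +
        ((s + x) ^ (p - 1) - s ^ (p - 1))), sum_const, nsmul_eq_mul] at hdiff
    · have hcard := card_filter_add_card_filter_not (s := A) (fun b => t b ≠ 0)
      have hpos : 0 < #{b ∈ A | ¬ t b ≠ 0} := card_pos.2 ⟨a, by simp [ha, hta]⟩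
      have hne : ((#{b ∈ A | ¬ t b ≠ 0} : ℕ) : R) ≠ 0 := fun h0 => by
        have := Nat.le_of_dvd hpos ((CharP.cast_eq_zero_iff R p _).1 h0)
        omega
      linear_combination (mul_eq_zero.1 hdiff).resolve_left hne
    · intro b hb
      simp only [mem_filter, not_not] at hb
      rw [hb.2, add_zero, ascendingSum_erase_eq_of_eq_zero t _ hb.1 ha hb.2 hta,
        ascendingSum_erase_eq_of_eq_zero t _ hb.1 ha hb.2 hta, hat_zero]
      ring
    · intro b hb
      simp only [mem_filter] at hb
      have h0 := hnonzero b hb.1 hb.2 0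
      rw [zero_add, add_zero] at h0
      rw [hnonzero b hb.1 hb.2, h0]
      ring

theorem sum_perm_prod_sum_Ici (n : ℕ) (t : Fin n → R) :
    ∑ σ : Equiv.Perm (Fin n), ∏ k, ∑ i ∈ Ici k, t (σ i) =
      (-1) ^ n * ascendingSum t n univ (-∑ i, t i) := by
  induction n with
  | zero => simp [ascendingSum_zero]
  | succ n ih =>
    rw [← Equiv.sum_comp Equiv.Perm.decomposeFin.symm, Fintype.sum_prod_type, ascendingSum_succ,
      mul_sum, mul_sum]
    refine sum_congr rfl fun a _ => ?_
    set e : Fin n ↪ Fin (n + 1) := (Fin.succEmb n).trans (Equiv.swap 0 a).toEmbedding with he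
    have himage : (univ : Finset (Fin n)).map e = univ.erase a := by
      rw [he, ← map_map]
      ext c
      rw [mem_map_equiv, Equiv.symm_swap, mem_erase]
      simp only [mem_map, mem_univ, true_and, and_true, Fin.coe_succEmb]
      rw [show (∃ b : Fin n, b.succ = Equiv.swap 0 a c) ↔ Equiv.swap 0 a c ≠ 0 from
        Fin.exists_succ_eq, Ne, Equiv.swap_apply_eq_iff, Equiv.swap_apply_left]
    have hsum : ∑ i, (t ∘ e) i = ∑ i, t i - t a := by
      rw [← add_sum_erase univ t (mem_univ a), ← himage, sum_map]
      simp
    have hfactor : ∀ τ : Equiv.Perm (Fin n),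
        ∏ k, ∑ i ∈ Ici k, t (Equiv.Perm.decomposeFin.symm (a, τ) i) =
          (∑ i, t i) * ∏ k, ∑ i ∈ Ici k, (t ∘ e) (τ i) := fun τ => by
      rw [Fin.prod_univ_succ]
      congr 1
      · rw [← Equiv.sum_comp (Equiv.Perm.decomposeFin.symm (a, τ)) t]
        congr 1
        ext; simp
      · refine prod_congr rfl fun k _ => ?_
        rw [← Fin.map_succEmb_Ici, sum_map]
        simp [he]
    rw [sum_congr rfl fun τ _ => hfactor τ, ← mul_sum, ih, hsum, ← himage, ascendingSum_map,
      show -∑ i, t i + t a = -(∑ i, t i - t a) by ring]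
    ring

theorem sum_perm_prod_sum_Iic (n : ℕ) (t : Fin n → R) :
    ∑ σ : Equiv.Perm (Fin n), ∏ k, ∑ i ∈ Iic k, t (σ i) =
      (-1) ^ n * ascendingSum t n univ (-∑ i, t i) := by
  rw [← sum_perm_prod_sum_Ici, ← Equiv.sum_comp (Equiv.mulRight Fin.revPerm)]
  refine sum_congr rfl fun σ _ => ?_
  rw [← Equiv.prod_comp Fin.revPerm]
  refine prod_congr rfl fun k _ => ?_
  refine sum_nbij' Fin.rev Fin.rev ?_ ?_ ?_ ?_ ?_
  · intro i hi; simpa [Fin.le_rev_iff] using hi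
  · intro i hi; simpa using hi
  · simp
  · simp
  · simp

end AscendingSum

theorem sum_perm_partial_sums_mul_sum_eq_sum_pow (p : ℕ) (hp : p.Prime) :
    (∑ σ : Equiv.Perm (Fin (p - 1)),
        ∏ k : Fin (p - 1), (∑ i ∈ Finset.Iic k, MvPolynomial.X (σ i) :
          MvPolynomial (Fin (p - 1)) (ZMod p)))
        * (∑ i : Fin (p - 1), MvPolynomial.X i)
      = ∑ i : Fin (p - 1), (MvPolynomial.X i) ^ p := by
  have := Fact.mk hp
  have hp2 := hp.two_le
  have : Nonempty (Fin (p - 1)) := ⟨⟨0, by omega⟩⟩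
  let t : Option (Fin (p - 1)) → MvPolynomial (Fin (p - 1)) (ZMod p) :=
    fun o => o.elim 0 MvPolynomial.X
  have huniv : (univ : Finset (Fin (p - 1))).map Function.Embedding.some = univ.erase none := by
    ext o
    cases o <;> simp
  have hA : #(univ : Finset (Option (Fin (p - 1)))) = p := by
    rw [card_univ, Fintype.card_option, Fintype.card_fin]
    omega
  have hsum : ∑ o, t o = ∑ i, MvPolynomial.X i := by simp [t, Fintype.sum_option]
  have hmain := ascendingSum_erase_eq_pow_sub_pow hp hA t (mem_univ none) rfl
    (-∑ i, MvPolynomial.X i)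
  rw [← huniv, ascendingSum_map, hsum, add_neg_cancel, zero_pow (by omega), sub_zero] at hmain
  have hsign : (-1 : MvPolynomial (Fin (p - 1)) (ZMod p)) ^ (p - 1) = 1 := by
    have h := congrArg (MvPolynomial.C (σ := Fin (p - 1)))
      (ZMod.pow_card_sub_one_eq_one (neg_ne_zero.2 (one_ne_zero (α := ZMod p))))
    simpa only [map_pow, map_neg, map_one] using h
  have ht : t ∘ (Function.Embedding.some : Fin (p - 1) ↪ _) = MvPolynomial.X := rfl
  rw [sum_perm_prod_sum_Iic, hsign, one_mul]
  rw [ht] at hmain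
  rw [hmain, ← pow_succ, Nat.sub_add_cancel hp.one_le, sum_pow_char]
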